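/- arXiv:1604.01115 — 2 statements merged into one kernel-verified Lean document; each statement's English description precedes it below -/
import Mathlib

section
/- Assume −1 ≤ a < b < c ≤ 1 and |y| ≤ 1, and set x := (b−a)/(c−a). Then for all real α, β, γ > 0 with β + γ > α, one has ∫_a^b (u−a)^{β−1} (b−u)^{γ−1} (c−u)^{−α} · ₂F₁(α, β; γ; y·(b−u)/(c−u)) du = (Γ(β)Γ(γ) / (Γ(β+γ−α)Γ(α))) · (b−a)^{β+γ−1} (c−a)^{−γ} (c−b)^{γ−α} (1 − xy)^{−β} · ∫₀^1 t^{β+γ−α−1} (1−t)^{α−1} (1 − xt)^{β−γ} (1 − (x(1−y)/(1−xy))·t)^{−β} dt. -/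
open Real MeasureTheory

/-- The Pochhammer symbol `(a)_n = a(a+1)⋯(a+n−1)`, with `(a)_0 = 1`. -/
noncomputable def poch (a : ℝ) (n : ℕ) : ℝ := ∏ i ∈ Finset.range n, (a + i)

/-- The Gauss hypergeometric function `₂F₁(a,b;c;z) = Σₙ ((a)ₙ(b)ₙ/(c)ₙ) zⁿ/n!`. -/
noncomputable def hyp2F1 (a b c z : ℝ) : ℝ :=
  ∑' n : ℕ, poch a n * poch b n / poch c n * z ^ n / (n.factorial : ℝ)

theorem poch_eq_eval_ascPochhammer (a : ℝ) (n : ℕ) :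
    poch a n = (ascPochhammer ℝ n).eval a := by
  induction n with
  | zero => simp [poch]
  | succ n ih => rw [ascPochhammer_succ_eval, ← ih, poch, Finset.prod_range_succ, poch]

theorem poch_pos {a : ℝ} (ha : 0 < a) (n : ℕ) : 0 < poch a n :=
  Finset.prod_pos fun i _ => by positivity

theorem poch_add (a : ℝ) (n m : ℕ) : poch a (n + m) = poch a n * poch (a + n) m := by
  simp only [poch, Finset.prod_range_add, Nat.cast_add, add_assoc]

theorem Gamma_add_natCast {a : ℝ} (ha : 0 < a) (n : ℕ) :
    Real.Gamma (a + n) = poch a n * Real.Gamma a := by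
  induction n with
  | zero => simp [poch]
  | succ n ih =>
    have h : a + n ≠ 0 := by positivity
    rw [Nat.cast_add_one, ← add_assoc, Real.Gamma_add_one h, ih, poch, poch,
      Finset.prod_range_succ]
    ring

theorem hasSum_poch_div_factorial_mul_pow (a : ℝ) {z : ℝ} (hz : |z| < 1) :
    HasSum (fun n : ℕ => poch a n / n.factorial * z ^ n) ((1 - z) ^ (-a)) := by
  have h := (Real.one_div_one_sub_rpow_hasFPowerSeriesOnBall_zero a).hasSum
    (y := z) (by simpa [enorm_eq_nnnorm] using! hz)
  have hz' : 0 ≤ 1 - z := by linarith [(abs_lt.1 hz).2]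
  simp only [zero_add, one_div, ← Real.rpow_neg hz'] at h
  convert! h using 2 with n
  have : poch a n = n.factorial * Ring.choose (a + n - 1) n := by
    rw [poch_eq_eval_ascPochhammer, ← Polynomial.ascPochhammer_smeval_eq_eval,
      ← Ring.factorial_nsmul_multichoose_eq_ascPochhammer, nsmul_eq_mul, Ring.choose]
    congr 2
    ring
  rw [this]
  have : (n.factorial : ℝ) ≠ 0 := by positivity
  simp
  field_simp

theorem summable_hyp2F1_term {a b c : ℝ} (ha : 0 < a) (hb : 0 < b) (hc : 0 < c) {z : ℝ}
    (hz : |z| < 1) :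
    Summable fun n : ℕ => poch a n * poch b n / poch c n * z ^ n / (n.factorial : ℝ) := by
  have hr := ordinaryHypergeometricSeries_radius_eq_one ℝ a b c (fun k => by
    have : (0 : ℝ) ≤ k := k.cast_nonneg
    refine ⟨?_, ?_, ?_⟩ <;> linarith)
  have h := (ordinaryHypergeometricSeries ℝ a b c).summable (x := z)
    (by rw [hr]; simpa [enorm_eq_nnnorm] using! hz)
  refine h.congr fun n => ?_
  rw [ordinaryHypergeometricSeries_apply_eq, ← poch_eq_eval_ascPochhammer,
    ← poch_eq_eval_ascPochhammer, ← poch_eq_eval_ascPochhammer, smul_eq_mul]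
  ring

theorem integrableOn_beta {p q : ℝ} (hp : 0 < p) (hq : 0 < q) :
    IntegrableOn (fun t : ℝ => t ^ (p - 1) * (1 - t) ^ (q - 1)) (Set.Ioo 0 1) := by
  have h := (intervalIntegrable_iff_integrableOn_Ioo_of_le zero_le_one).1
    (Complex.betaIntegral_convergent (u := p) (v := q) (by simpa) (by simpa))
  refine (integrableOn_congr_fun (fun t ht => ?_) measurableSet_Ioo).1 h.re
  have h1 : 0 ≤ t := ht.1.le
  have h2 : 0 ≤ 1 - t := sub_nonneg.2 ht.2.le
  simp only [RCLike.re_to_complex]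
  norm_cast
  rw [← Complex.ofReal_cpow h1, ← Complex.ofReal_cpow h2]
  norm_cast

theorem integral_beta {p q : ℝ} (hp : 0 < p) (hq : 0 < q) :
    ∫ t in Set.Ioo (0 : ℝ) 1, t ^ (p - 1) * (1 - t) ^ (q - 1) =
      Real.Gamma p * Real.Gamma q / Real.Gamma (p + q) := by
  have h := Complex.betaIntegral_eq_Gamma_mul_div p q (by simpa) (by simpa)
  rw [Complex.betaIntegral, intervalIntegral.integral_of_le zero_le_one,
    integral_Ioc_eq_integral_Ioo] at h
  rw [← Complex.ofReal_inj, ← integral_complex_ofReal]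
  push_cast
  rw [← Complex.Gamma_ofReal, ← Complex.Gamma_ofReal, ← Complex.Gamma_ofReal,
    Complex.ofReal_add, ← h]
  refine setIntegral_congr_fun measurableSet_Ioo fun t ht => ?_
  have h1 : 0 ≤ t := ht.1.le
  have h2 : 0 ≤ 1 - t := sub_nonneg.2 ht.2.le
  simp only [Complex.ofReal_cpow h1, Complex.ofReal_cpow h2]
  push_cast
  rfl

theorem hasSum_poch_mul_poch {b g v w : ℝ} (hb : 0 < b) (hg : 0 < g) (hv : 0 ≤ v)
    (hw : |w| < 1 - v) :
    HasSum (fun p : ℕ × ℕ => poch b p.1 / p.1.factorial * w ^ p.1 *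
      (poch (g + p.1) p.2 / p.2.factorial * v ^ p.2)) ((1 - v) ^ (b - g) * (1 - v - w) ^ (-b)) := by
  have hv1 : 0 < 1 - v := (abs_nonneg w).trans_lt hw
  have hav : |v| < 1 := by rw [abs_of_nonneg hv]; linarith
  have fiber (w : ℝ) (n : ℕ) : HasSum (fun m : ℕ => poch b n / n.factorial * w ^ n *
      (poch (g + n) m / m.factorial * v ^ m))
      ((1 - v) ^ (-g) * (poch b n / n.factorial * (w / (1 - v)) ^ n)) := by
    convert! (hasSum_poch_div_factorial_mul_pow (g + n) hav).mul_left
      (poch b n / n.factorial * w ^ n) using 1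
    rw [neg_add, Real.rpow_add hv1, Real.rpow_neg hv1.le (n : ℝ), Real.rpow_natCast, div_pow]
    ring
  have outer {w : ℝ} (hw : |w| < 1 - v) :
      HasSum (fun n : ℕ => (1 - v) ^ (-g) * (poch b n / n.factorial * (w / (1 - v)) ^ n))
        ((1 - v) ^ (-g) * (1 - w / (1 - v)) ^ (-b)) :=
    (hasSum_poch_div_factorial_mul_pow b
      (by rwa [abs_div, abs_of_pos hv1, div_lt_one hv1])).mul_left _
  have hsum : Summable fun p : ℕ × ℕ => poch b p.1 / p.1.factorial * w ^ p.1 *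
      (poch (g + p.1) p.2 / p.2.factorial * v ^ p.2) := by
    have h : Summable fun p : ℕ × ℕ => poch b p.1 / p.1.factorial * |w| ^ p.1 *
        (poch (g + p.1) p.2 / p.2.factorial * v ^ p.2) := by
      refine (summable_prod_of_nonneg fun p => ?_).2 ⟨fun n => (fiber |w| n).summable, ?_⟩
      · have := poch_pos hb p.1
        have := poch_pos (a := g + p.1) (by positivity) p.2
        simp only [Pi.zero_apply]
        positivity
      · simp only [(fiber |w| _).tsum_eq]
        exact (outer (by rwa [abs_abs])).summable
    refine h.of_norm_bounded fun p => le_of_eq ?_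
    have := poch_pos hb p.1
    have := poch_pos (a := g + p.1) (by positivity) p.2
    simp only [norm_mul, norm_div, norm_pow, Real.norm_eq_abs, Nat.abs_cast, abs_of_pos, *,
      abs_of_nonneg]
  have h := (hsum.hasSum.prod_fiberwise (fiber w)).unique (outer hw)
  have hvw : 0 < 1 - v - w := by linarith [(abs_lt.1 hw).2]
  have e : (1 - v) ^ (b - g) * (1 - v - w) ^ (-b) =
      (1 - v) ^ (-g) * (1 - w / (1 - v)) ^ (-b) := by
    have : 1 - w / (1 - v) = (1 - v - w) / (1 - v) := by field_simp
    rw [this, Real.div_rpow hvw.le hv1.le, show b - g = -g + b by ring, Real.rpow_add hv1,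
      Real.rpow_neg hv1.le b]
    field_simp
  rw [e, ← h]
  exact hsum.hasSum

theorem integral_norm_const_mul_beta (A p q : ℝ) :
    ∫ t in Set.Ioo (0 : ℝ) 1, ‖A * (t ^ (p - 1) * (1 - t) ^ (q - 1))‖ =
      ‖∫ t in Set.Ioo (0 : ℝ) 1, A * (t ^ (p - 1) * (1 - t) ^ (q - 1))‖ := by
  have h0 : ∀ t ∈ Set.Ioo (0 : ℝ) 1, 0 ≤ t ^ (p - 1) * (1 - t) ^ (q - 1) := fun t ht =>
    mul_nonneg (Real.rpow_nonneg ht.1.le _) (Real.rpow_nonneg (sub_nonneg.2 ht.2.le) _)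
  rw [integral_const_mul, norm_mul, Real.norm_of_nonneg (setIntegral_nonneg measurableSet_Ioo h0),
    ← integral_const_mul]
  refine setIntegral_congr_fun measurableSet_Ioo fun t ht => ?_
  simp only [norm_mul A, Real.norm_of_nonneg (h0 t ht)]

theorem rpow_add_natCast_sub_one {t : ℝ} (ht : 0 < t) (p : ℝ) (n : ℕ) :
    t ^ (p + n - 1) = t ^ (p - 1) * t ^ n := by
  rw [← Real.rpow_natCast, ← Real.rpow_add ht]
  congr 1
  ring

theorem integral_beta_mul_hyp2F1 {x y α β γ : ℝ} (hx0 : 0 < x) (hx1 : x < 1) (hy : |y| ≤ 1)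
    (hα : 0 < α) (hβ : 0 < β) (hγ : 0 < γ) (hβγ : α < β + γ) :
    ∫ s in Set.Ioo (0 : ℝ) 1, s ^ (γ - 1) * (1 - s) ^ (β - 1) * (1 - x * s) ^ (-(β + γ - α)) *
        hyp2F1 α β γ (x * y * s) =
      Real.Gamma β * Real.Gamma γ / (Real.Gamma (β + γ - α) * Real.Gamma α) *
        ∫ t in Set.Ioo (0 : ℝ) 1, t ^ (β + γ - α - 1) * (1 - t) ^ (α - 1) *
          (1 - x * t) ^ (β - γ) * (1 - x * t - x * y * (1 - t)) ^ (-β) := by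
  set δ := β + γ - α with hδ_def
  have hδ : 0 < δ := by linarith
  have hxy : |x * y| ≤ x := by
    rw [abs_mul, abs_of_pos hx0]
    exact mul_le_of_le_one_right hx0.le hy
  have hax : |x| < 1 := by rwa [abs_of_pos hx0]
  have hΓα := Real.Gamma_pos_of_pos hα
  have hΓβ := Real.Gamma_pos_of_pos hβ
  have hΓγ := Real.Gamma_pos_of_pos hγ
  have hΓδ := Real.Gamma_pos_of_pos hδ
  obtain ⟨K, hK_def⟩ : ∃ K, K = Real.Gamma β * Real.Gamma γ / (Real.Gamma δ * Real.Gamma α) :=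
    ⟨_, rfl⟩
  have hK : 0 < K := by rw [hK_def]; positivity
  rw [← hK_def]
  obtain ⟨A, hA⟩ : ∃ A : ℕ × ℕ → ℝ, ∀ p, A p = poch α p.1 * poch β p.1 / poch γ p.1 *
      (x * y) ^ p.1 / (p.1.factorial : ℝ) * (poch δ p.2 / p.2.factorial * x ^ p.2) :=
    ⟨_, fun _ => rfl⟩
  obtain ⟨B, hB⟩ : ∃ B : ℕ × ℕ → ℝ, ∀ p, B p = poch β p.1 / p.1.factorial * (x * y) ^ p.1 *
      (poch (γ + p.1) p.2 / p.2.factorial * x ^ p.2) := ⟨_, fun _ => rfl⟩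
  obtain ⟨F, hF⟩ : ∃ F : ℕ × ℕ → ℝ → ℝ, ∀ p, F p = fun s =>
      A p * (s ^ (γ + (p.1 + p.2 : ℕ) - 1) * (1 - s) ^ (β - 1)) := ⟨_, fun _ => rfl⟩
  obtain ⟨G, hG⟩ : ∃ G : ℕ × ℕ → ℝ → ℝ, ∀ p, G p = fun t =>
      B p * (t ^ (δ + p.2 - 1) * (1 - t) ^ (α + p.1 - 1)) := ⟨_, fun _ => rfl⟩
  have hΓ (p : ℕ × ℕ) : Real.Gamma (γ + (p.1 + p.2 : ℕ) + β) =
      poch (γ + β) (p.1 + p.2) * Real.Gamma (γ + β) := by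
    rw [← Gamma_add_natCast (by positivity)]
    congr 1
    ring
  have iF (p : ℕ × ℕ) : ∫ s in Set.Ioo (0 : ℝ) 1, F p s = A p *
      (poch γ (p.1 + p.2) / poch (γ + β) (p.1 + p.2) *
        (Real.Gamma γ * Real.Gamma β / Real.Gamma (γ + β))) := by
    simp only [hF]
    rw [integral_const_mul, integral_beta (by positivity) hβ, hΓ, Gamma_add_natCast hγ,
      mul_assoc (poch _ _), mul_div_mul_comm]
  have iFG (p : ℕ × ℕ) : ∫ s in Set.Ioo (0 : ℝ) 1, F p s =
      K * ∫ t in Set.Ioo (0 : ℝ) 1, G p t := by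
    rw [iF]
    simp only [hG]
    have e : δ + p.2 + (α + p.1) = γ + (p.1 + p.2 : ℕ) + β := by
      push_cast
      rw [hδ_def]
      ring
    rw [integral_const_mul, integral_beta (by positivity) (by positivity), e, hΓ,
      Gamma_add_natCast hδ, Gamma_add_natCast hα, hA, hB, hK_def, poch_add γ]
    have := poch_pos hγ p.1
    have := poch_pos (add_pos hγ hβ) (p.1 + p.2)
    have := Real.Gamma_pos_of_pos (add_pos hγ hβ)
    field_simp
  have sA : Summable fun p => ‖A p‖ := by
    simp only [hA]
    have h1 := (summable_hyp2F1_term hα hβ hγ (hxy.trans_lt hx1)).norm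
    have h2 := (hasSum_poch_div_factorial_mul_pow δ hax).summable.norm
    have h3 := h1.mul_norm h2
    exact h3
  have sF : Summable fun p => ∫ s in Set.Ioo (0 : ℝ) 1, ‖F p s‖ := by
    simp only [hF, integral_norm_const_mul_beta]
    refine (sA.mul_right (Real.Gamma γ * Real.Gamma β / Real.Gamma (γ + β))).of_nonneg_of_le
      (fun p => norm_nonneg _) fun p => ?_
    have h := iF p
    simp only [hF] at h
    rw [h, norm_mul]
    have h1 := poch_pos hγ (p.1 + p.2)
    have h2 := poch_pos (add_pos hγ hβ) (p.1 + p.2)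
    have h3 := Real.Gamma_pos_of_pos (add_pos hγ hβ)
    rw [Real.norm_of_nonneg (r := _ / _ * _) (by positivity)]
    refine mul_le_mul_of_nonneg_left (mul_le_of_le_one_left (by positivity) ?_) (norm_nonneg _)
    rw [div_le_one h2]
    exact Finset.prod_le_prod (fun i _ => by positivity) fun i _ => by linarith
  have sG : Summable fun p => ∫ t in Set.Ioo (0 : ℝ) 1, ‖G p t‖ := by
    refine (sF.mul_left K⁻¹).congr fun p => ?_
    have h := iFG p
    simp only [hF, hG] at h
    simp only [hF, hG, integral_norm_const_mul_beta]
    rw [h, norm_mul, Real.norm_of_nonneg hK.le, inv_mul_cancel_left₀ hK.ne']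
  have HF := hasSum_integral_of_summable_integral_norm (F := F) (fun p => by
    rw [hF]
    exact (integrableOn_beta (by positivity) hβ).const_mul (A p)) sF
  have HG := hasSum_integral_of_summable_integral_norm (F := G) (fun p => by
    rw [hG]
    exact (integrableOn_beta (by positivity) (by positivity)).const_mul (B p)) sG
  simp only [iFG] at HF
  have key := HF.unique (HG.mul_left K)
  refine Eq.trans ?_ (key.trans ?_)
  · refine setIntegral_congr_fun measurableSet_Ioo fun s hs => ?_
    have hs0 : |s| ≤ 1 := by rw [abs_of_pos hs.1]; exact hs.2.le
    have h1 : |x * y * s| < 1 := by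
      rw [abs_mul]
      exact (mul_le_of_le_one_right (abs_nonneg _) hs0).trans_lt (hxy.trans_lt hx1)
    have h2 : |x * s| < 1 := by
      rw [abs_mul]
      exact (mul_le_of_le_one_right (abs_nonneg _) hs0).trans_lt hax
    have h3 := hasSum_poch_div_factorial_mul_pow δ h2
    have h4 := summable_hyp2F1_term hα hβ hγ h1
    have h5 := tsum_mul_tsum_of_summable_norm h4.norm h3.summable.norm
    rw [h3.tsum_eq, ← hyp2F1] at h5
    have h6 : ∀ p, F p s = s ^ (γ - 1) * (1 - s) ^ (β - 1) *
        (poch α p.1 * poch β p.1 / poch γ p.1 * (x * y * s) ^ p.1 / (p.1.factorial : ℝ) *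
          (poch δ p.2 / p.2.factorial * (x * s) ^ p.2)) := fun p => by
      simp only [hF, hA, rpow_add_natCast_sub_one hs.1]
      ring
    simp only [h6]
    rw [tsum_mul_left, ← h5]
    ring
  · congr 1
    refine setIntegral_congr_fun measurableSet_Ioo fun t ht => ?_
    have ht' : 0 < 1 - t := sub_pos.2 ht.2
    have h1 : |x * y * (1 - t)| < 1 - x * t := by
      rw [abs_mul, abs_of_pos ht']
      nlinarith
    have h2 := hasSum_poch_mul_poch hβ hγ (mul_nonneg hx0.le ht.1.le) h1
    have h6 : ∀ p, G p t = t ^ (δ - 1) * (1 - t) ^ (α - 1) *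
        (poch β p.1 / p.1.factorial * (x * y * (1 - t)) ^ p.1 *
          (poch (γ + p.1) p.2 / p.2.factorial * (x * t) ^ p.2)) := fun p => by
      simp only [hG, hB, rpow_add_natCast_sub_one ht.1,
        rpow_add_natCast_sub_one ht', mul_pow]
      ring
    simp only [h6]
    rw [tsum_mul_left, h2.tsum_eq]
    ring

theorem rpow_mul_eq_of_moebius_substitution {B C E D s r : ℝ} (hB : 0 < B) (hC : 0 < C)
    (hE : 0 < E) (hD : 0 < D) (hs : 0 < s) (hr : 0 < r) (α β γ : ℝ) :
    E * (B / C) / D ^ 2 *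
        ((B * r / D) ^ (β - 1) * (E * (B / C * s) / D) ^ (γ - 1) * (E / D) ^ (-α)) =
      B ^ (β + γ - 1) * C ^ (-γ) * E ^ (γ - α) *
        (s ^ (γ - 1) * r ^ (β - 1) * D ^ (-(β + γ - α))) := by
  have h {z : ℝ} (hz : 0 < z) : ∃ w, z = Real.exp w := ⟨Real.log z, (Real.exp_log hz).symm⟩
  obtain ⟨B, rfl⟩ := h hB
  obtain ⟨C, rfl⟩ := h hC
  obtain ⟨E, rfl⟩ := h hE
  obtain ⟨D, rfl⟩ := h hD
  obtain ⟨s, rfl⟩ := h hs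
  obtain ⟨r, rfl⟩ := h hr
  simp only [← Real.exp_sub, ← Real.exp_add, ← Real.exp_mul, ← Real.exp_nat_mul]
  congr 1
  push_cast
  ring

theorem moebius_image_Ioo {a b c : ℝ} (h2 : a < b) (h3 : b < c) :
    (fun s => c - (c - b) / (1 - (b - a) / (c - a) * s)) '' Set.Ioo 0 1 = Set.Ioo a b := by
  have hca : 0 < c - a := by linarith
  have hcb : 0 < c - b := by linarith
  have hba : 0 < b - a := by linarith
  ext u
  constructor
  · rintro ⟨s, ⟨hs0, hs1⟩, rfl⟩
    have hD : 1 - (b - a) / (c - a) * s = (c - a - (b - a) * s) / (c - a) := by field_simp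
    have hD' : 0 < c - a - (b - a) * s := by nlinarith
    simp only [hD, Set.mem_Ioo, div_div_eq_mul_div]
    constructor
    · rw [lt_sub_comm, div_lt_iff₀ hD']
      nlinarith [mul_pos hca hba]
    · rw [sub_lt_comm, lt_div_iff₀ hD']
      nlinarith [mul_pos hcb hba]
  · rintro ⟨hu0, hu1⟩
    have hcu : 0 < c - u := by linarith
    refine ⟨(c - a) * (b - u) / ((b - a) * (c - u)), ⟨?_, ?_⟩, ?_⟩
    · have : 0 < b - u := by linarith
      positivity
    · rw [div_lt_one (by positivity)]
      nlinarith
    · have : 1 - (b - a) / (c - a) * ((c - a) * (b - u) / ((b - a) * (c - u))) =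
          (c - b) / (c - u) := by
        field_simp
        ring
      simp only [this]
      field_simp
      ring

/-- Lemma A.1 of Brauchart–Dragnev–Saff: for `−1 ≤ a < b < c ≤ 1`, `|y| ≤ 1`,
`x := (b−a)/(c−a)`, and real `α, β, γ > 0` with `β + γ > α`,
`∫_a^b (u−a)^{β−1}(b−u)^{γ−1}(c−u)^{−α} ₂F₁(α,β;γ; y(b−u)/(c−u)) du
  = (Γ(β)Γ(γ)/(Γ(β+γ−α)Γ(α))) (b−a)^{β+γ−1}(c−a)^{−γ}(c−b)^{γ−α}(1−xy)^{−β}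
    ∫₀¹ t^{β+γ−α−1}(1−t)^{α−1}(1−xt)^{β−γ}(1 − (x(1−y)/(1−xy)) t)^{−β} dt`. -/
theorem bds_lemma_A1 (a b c y α β γ : ℝ) (h1 : -1 ≤ a) (h2 : a < b) (h3 : b < c)
    (h4 : c ≤ 1) (hy : |y| ≤ 1) (hα : 0 < α) (hβ : 0 < β) (hγ : 0 < γ)
    (hβγ : α < β + γ) :
    (∫ u in a..b, (u - a) ^ (β - 1) * (b - u) ^ (γ - 1) * (c - u) ^ (-α)
        * hyp2F1 α β γ (y * (b - u) / (c - u)))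
      = Real.Gamma β * Real.Gamma γ / (Real.Gamma (β + γ - α) * Real.Gamma α)
        * (b - a) ^ (β + γ - 1) * (c - a) ^ (-γ) * (c - b) ^ (γ - α)
        * (1 - ((b - a)/(c - a)) * y) ^ (-β)
        * ∫ t in (0:ℝ)..1, t ^ (β + γ - α - 1) * (1 - t) ^ (α - 1)
            * (1 - ((b - a)/(c - a)) * t) ^ (β - γ)
            * (1 - (((b - a)/(c - a)) * (1 - y) / (1 - ((b - a)/(c - a)) * y)) * t) ^ (-β) := by
  have hca : 0 < c - a := by linarith
  have hcb : 0 < c - b := by linarith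
  have hba : 0 < b - a := by linarith
  have hx0 : 0 < (b - a) / (c - a) := by positivity
  have hx1 : (b - a) / (c - a) < 1 := by rw [div_lt_one hca]; linarith
  have core := integral_beta_mul_hyp2F1 hx0 hx1 hy hα hβ hγ hβγ
  have himage := moebius_image_Ioo h2 h3
  have hcb' : c - b = (c - a) * (1 - (b - a) / (c - a)) := by field_simp; ring
  have hba' : b - a = (c - a) * ((b - a) / (c - a)) := by field_simp
  set x := (b - a) / (c - a) with hx
  have hD : ∀ s ∈ Set.Ioo (0 : ℝ) 1, 0 < 1 - x * s := fun s hs => by nlinarith [hs.1, hs.2]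
  have hxy : 0 < 1 - x * y := by nlinarith [(abs_le.1 hy).2]
  rw [intervalIntegral.integral_of_le h2.le, integral_Ioc_eq_integral_Ioo,
    intervalIntegral.integral_of_le zero_le_one, integral_Ioc_eq_integral_Ioo, ← himage,
    integral_image_eq_integral_abs_deriv_smul (f' := fun s => -((c - b) * x / (1 - x * s) ^ 2))
      measurableSet_Ioo]
  · calc
      _ = ∫ s in Set.Ioo (0 : ℝ) 1, (b - a) ^ (β + γ - 1) * (c - a) ^ (-γ) * (c - b) ^ (γ - α) *
          (s ^ (γ - 1) * (1 - s) ^ (β - 1) * (1 - x * s) ^ (-(β + γ - α)) *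
            hyp2F1 α β γ (x * y * s)) := by
        refine setIntegral_congr_fun measurableSet_Ioo fun s hs => ?_
        have hs' : 0 < 1 - s := sub_pos.2 hs.2
        have hDs := hD s hs
        have e1 : c - (c - b) / (1 - x * s) - a = (b - a) * (1 - s) / (1 - x * s) := by
          rw [hcb', hba']
          field_simp
          ring
        have e2 : b - (c - (c - b) / (1 - x * s)) = (c - b) * (x * s) / (1 - x * s) := by
          field_simp
          ring
        have e3 : c - (c - (c - b) / (1 - x * s)) = (c - b) / (1 - x * s) := by ring
        have e4 : y * ((c - b) * (x * s) / (1 - x * s)) / ((c - b) / (1 - x * s)) =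
            x * y * s := by
          field_simp
        have e5 : |-((c - b) * x / (1 - x * s) ^ 2)| = (c - b) * x / (1 - x * s) ^ 2 := by
          rw [abs_neg, abs_of_pos (by positivity)]
        have e6 := rpow_mul_eq_of_moebius_substitution hba hca hcb hDs hs.1 hs' α β γ
        rw [← hx] at e6
        simp only [e1, e2, e3, e4, e5, smul_eq_mul]
        rw [← mul_assoc, e6]
        ring
      _ = _ := by
        rw [integral_const_mul, core]
        have e : ∫ t in Set.Ioo (0 : ℝ) 1, t ^ (β + γ - α - 1) * (1 - t) ^ (α - 1) *
              (1 - x * t) ^ (β - γ) * (1 - x * t - x * y * (1 - t)) ^ (-β) =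
            (1 - x * y) ^ (-β) * ∫ t in Set.Ioo (0 : ℝ) 1, t ^ (β + γ - α - 1) *
              (1 - t) ^ (α - 1) * (1 - x * t) ^ (β - γ) *
              (1 - x * (1 - y) / (1 - x * y) * t) ^ (-β) := by
          rw [← integral_const_mul]
          refine setIntegral_congr_fun measurableSet_Ioo fun t ht => ?_
          have h0 : 0 < 1 - x * t - x * y * (1 - t) := by
            nlinarith [mul_pos hx0 ht.1, mul_le_mul_of_nonneg_left (abs_le.1 hy).2
              (mul_pos hx0 (sub_pos.2 ht.2)).le]
          have h : 1 - x * (1 - y) / (1 - x * y) * t =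
              (1 - x * t - x * y * (1 - t)) / (1 - x * y) := by
            field_simp
            ring
          have hne : (1 - x * y) ^ (-β) ≠ 0 := (Real.rpow_pos_of_pos hxy _).ne'
          simp only [h, Real.div_rpow h0.le hxy.le]
          field_simp
        rw [e]
        ring
  · intro s hs
    have h := (((hasDerivAt_id s).const_mul x).const_sub 1).fun_inv (hD s hs).ne'
    refine ((h.const_mul (c - b)).const_sub c).hasDerivWithinAt.congr_deriv ?_
    simp only [id]
    ring
  · intro s hs t ht hst
    have := hD s hs
    have := hD t ht
    simp only [sub_right_inj] at hst
    rw [div_eq_div_iff (by positivity) (by positivity)] at hst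
    have := mul_left_cancel₀ hcb.ne' hst
    exact mul_left_cancel₀ hx0.ne' (by linarith)
end

section
/- Let d ≥ 3 be an integer and let 0 < α < π. Then ∫_α^π (1 + cos η)^{(d−3)/2} · sin η / ((1 − cos η) · √(cos α − cos η)) dη = (√π · 2^{(d−3)/2} · Γ((d−1)/2) / Γ(d/2 − 1)) · (1 − cos α)^{−1/2} · B(cos²(α/2); (d−2)/2, 1/2). -/
open Real MeasureTheory

/-- The incomplete Beta function `B(z; a, b) = ∫₀^z t^{a−1}(1−t)^{b−1} dt`. -/
noncomputable def incBeta (z a b : ℝ) : ℝ := ∫ t in (0:ℝ)..z, t ^ (a - 1) * (1 - t) ^ (b - 1)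

lemma one_sub_sin_sq_mul_sin_sq_pos {φ : ℝ} (hφ : 0 < cos φ) (θ : ℝ) :
    0 < 1 - sin φ ^ 2 * sin θ ^ 2 := by
  nlinarith [sin_sq_add_cos_sq φ, sin_sq_add_cos_sq θ, mul_pos hφ hφ,
    mul_nonneg (sq_nonneg (sin φ)) (sq_nonneg (cos θ))]

lemma continuous_sin_pow_div {φ : ℝ} (hφ : 0 < cos φ) (n : ℕ) :
    Continuous fun θ ↦ sin θ ^ n / (1 - sin φ ^ 2 * sin θ ^ 2) :=
  Continuous.div (by fun_prop) (by fun_prop)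
    fun θ ↦ (one_sub_sin_sq_mul_sin_sq_pos hφ θ).ne'

lemma sin_sq_mul_integral_sin_pow_div {φ : ℝ} (hφ : 0 < cos φ) (n : ℕ) :
    sin φ ^ 2 * ∫ θ in 0..π / 2, sin θ ^ (n + 2) / (1 - sin φ ^ 2 * sin θ ^ 2) =
      (∫ θ in 0..π / 2, sin θ ^ n / (1 - sin φ ^ 2 * sin θ ^ 2)) -
        ∫ θ in 0..π / 2, sin θ ^ n := by
  rw [← intervalIntegral.integral_sub ((continuous_sin_pow_div hφ n).intervalIntegrable _ _)
    (Continuous.intervalIntegrable (by fun_prop) _ _), ← intervalIntegral.integral_const_mul]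
  refine intervalIntegral.integral_congr fun θ _ ↦ ?_
  have := (one_sub_sin_sq_mul_sin_sq_pos hφ θ).ne'
  field_simp
  ring

lemma integral_one_div_one_sub_sin_sq_mul_sin_sq {φ : ℝ} (hφ : 0 < cos φ) :
    ∫ θ in 0..π / 2, sin θ ^ 0 / (1 - sin φ ^ 2 * sin θ ^ 2) = π / 2 / cos φ := by
  have key (θ : ℝ) : HasDerivAt (fun θ ↦ (θ - arctan ((1 - cos φ) * (sin θ * cos θ) /
      (cos θ ^ 2 + cos φ * sin θ ^ 2))) / cos φ)
      (sin θ ^ 0 / (1 - sin φ ^ 2 * sin θ ^ 2)) θ := by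
    have hD : 0 < cos θ ^ 2 + cos φ * sin θ ^ 2 := by
      by_cases hs : sin θ = 0
      · nlinarith [sin_sq_add_cos_sq θ]
      · have := mul_pos hφ (pow_two_pos_of_ne_zero hs)
        positivity
    have hN : HasDerivAt (fun θ ↦ (1 - cos φ) * (sin θ * cos θ))
        ((1 - cos φ) * (cos θ * cos θ + sin θ * -sin θ)) θ :=
      ((hasDerivAt_sin θ).mul (hasDerivAt_cos θ)).const_mul _
    have hD' : HasDerivAt (fun θ ↦ cos θ ^ 2 + cos φ * sin θ ^ 2)
        (2 * cos θ * -sin θ + cos φ * (2 * sin θ * cos θ)) θ := by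
      simpa using ((hasDerivAt_cos θ).pow 2).fun_add (((hasDerivAt_sin θ).pow 2).const_mul (cos φ))
    refine (((hasDerivAt_id θ).sub (hN.fun_div hD' hD.ne').arctan).div_const (cos φ)).congr_deriv ?_
    have h1 := one_sub_sin_sq_mul_sin_sq_pos hφ θ
    have h2 : 1 - sin φ ^ 2 * sin θ ^ 2 = cos θ ^ 2 + cos φ ^ 2 * sin θ ^ 2 := by
      rw [sin_sq φ, cos_sq' θ]; ring
    have h3 : (cos θ ^ 2 + cos φ * sin θ ^ 2) ^ 2 + ((1 - cos φ) * (sin θ * cos θ)) ^ 2 =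
        cos θ ^ 2 + cos φ ^ 2 * sin θ ^ 2 := by
      linear_combination (cos θ ^ 2 + cos φ ^ 2 * sin θ ^ 2) * sin_sq_add_cos_sq θ
    rw [h2] at h1 ⊢
    have h4 : 1 + ((1 - cos φ) * (sin θ * cos θ) / (cos θ ^ 2 + cos φ * sin θ ^ 2)) ^ 2 =
        (cos θ ^ 2 + cos φ ^ 2 * sin θ ^ 2) / (cos θ ^ 2 + cos φ * sin θ ^ 2) ^ 2 := by
      rw [← h3]; field_simp
    rw [h4]
    field_simp
    linear_combination (cos φ * (sin θ ^ 2 + cos θ ^ 2) + cos φ - cos θ ^ 2 -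
      cos φ ^ 2 * sin θ ^ 2) * sin_sq_add_cos_sq θ
  rw [intervalIntegral.integral_eq_sub_of_hasDerivAt (fun θ _ ↦ key θ)
    ((continuous_sin_pow_div hφ 0).intervalIntegrable _ _)]
  simp

lemma integral_sin_div_one_sub_sin_sq_mul_sin_sq {φ : ℝ} (h0 : 0 < φ) (h1 : φ < π / 2) :
    ∫ θ in 0..π / 2, sin θ ^ 1 / (1 - sin φ ^ 2 * sin θ ^ 2) = φ / (sin φ * cos φ) := by
  have hc : 0 < cos φ := cos_pos_of_mem_Ioo ⟨by linarith, h1⟩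
  have hs : 0 < sin φ := sin_pos_of_pos_of_lt_pi h0 (by linarith [pi_pos])
  have key (θ : ℝ) : HasDerivAt (fun θ ↦ -arctan (tan φ * cos θ) / (sin φ * cos φ))
      (sin θ ^ 1 / (1 - sin φ ^ 2 * sin θ ^ 2)) θ := by
    refine ((((hasDerivAt_cos θ).const_mul (tan φ)).arctan).neg.div_const _).congr_deriv ?_
    have h1 := one_sub_sin_sq_mul_sin_sq_pos hc θ
    have h2 : 1 - sin φ ^ 2 * sin θ ^ 2 = cos φ ^ 2 + sin φ ^ 2 * cos θ ^ 2 := by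
      rw [cos_sq' φ, cos_sq' θ]; ring
    rw [h2] at h1 ⊢
    rw [tan_eq_sin_div_cos]
    have h4 : 1 + (sin φ / cos φ * cos θ) ^ 2 =
        (cos φ ^ 2 + sin φ ^ 2 * cos θ ^ 2) / cos φ ^ 2 := by
      field_simp
    rw [h4]
    field_simp
  rw [intervalIntegral.integral_eq_sub_of_hasDerivAt (fun θ _ ↦ key θ)
    ((continuous_sin_pow_div hc 1).intervalIntegrable _ _)]
  simp [arctan_tan (by linarith : -(π / 2) < φ) h1, neg_div]

lemma integral_sin_pow_zero_pi_div_two (n : ℕ) :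
    ∫ θ in 0..π / 2, sin θ ^ (n + 2) = (n + 1) / (n + 2) * ∫ θ in 0..π / 2, sin θ ^ n := by
  simp [integral_sin_pow]

lemma succ_mul_integral_sin_pow_eq_Gamma (n : ℕ) :
    (n + 1) * ∫ θ in 0..π / 2, sin θ ^ (n + 1) =
      √π * Gamma ((n + 2) / 2) / Gamma ((n + 1) / 2) := by
  induction n using Nat.twoStepInduction with
  | zero =>
    have : √π ≠ 0 := (sqrt_pos.2 pi_pos).ne'
    rw [CharP.cast_eq_zero, zero_add, zero_add, Gamma_one_half_eq]
    simp [this]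
  | one =>
    have h : Gamma ((1 + 2) / 2) = 1 / 2 * √π := by
      rw [← Gamma_one_half_eq, ← Gamma_add_one (by norm_num)]; norm_num
    have h' : √π * √π = π := mul_self_sqrt pi_pos.le
    norm_num at h ⊢
    rw [h]
    linear_combination (-1 / 2) * h'
  | more n ih _ =>
    rw [show n + 2 + 1 = n + 1 + 2 by ring, integral_sin_pow_zero_pi_div_two]
    push_cast
    rw [show ((n : ℝ) + 2 + 2) / 2 = (n + 2) / 2 + 1 by ring,
      show ((n : ℝ) + 2 + 1) / 2 = (n + 1) / 2 + 1 by ring,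
      Gamma_add_one (by positivity), Gamma_add_one (by positivity)]
    have : Gamma ((n + 1) / 2) ≠ 0 := (Gamma_pos_of_pos (by positivity)).ne'
    field_simp at ih ⊢
    linear_combination (n + 2) * (n + 3) * ih

lemma sin_pow_mul_cos_mul_integral {φ : ℝ} (h0 : 0 < φ) (h1 : φ < π / 2) (n : ℕ) :
    sin φ ^ (n + 1) * cos φ *
        ∫ θ in 0..π / 2, sin θ ^ (n + 1) / (1 - sin φ ^ 2 * sin θ ^ 2) =
      ((n + 1) * ∫ θ in 0..π / 2, sin θ ^ (n + 1)) * ∫ θ in 0..φ, sin θ ^ n := by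
  have hc : 0 < cos φ := cos_pos_of_mem_Ioo ⟨by linarith, h1⟩
  have hs : 0 < sin φ := sin_pos_of_pos_of_lt_pi h0 (by linarith [pi_pos])
  induction n using Nat.twoStepInduction with
  | zero =>
    rw [zero_add, integral_sin_div_one_sub_sin_sq_mul_sin_sq h0 h1]
    simp
    field_simp
  | one =>
    have h := sin_sq_mul_integral_sin_pow_div hc 0
    rw [integral_one_div_one_sub_sin_sq_mul_sin_sq hc] at h
    have e : π / 2 / cos φ * cos φ = π / 2 := by field_simp
    simp only [zero_add, pow_zero, integral_one, sub_zero] at h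
    simp only [Nat.reduceAdd, integral_sin_sq, pow_one, integral_sin, Nat.cast_one, sin_zero,
      cos_zero, cos_pi_div_two]
    linear_combination cos φ * h + e
  | more n ih _ =>
    have h := sin_sq_mul_integral_sin_pow_div hc (n + 1)
    have hS := integral_sin_pow (a := 0) (b := φ) n
    simp only [sin_zero, cos_zero, ne_eq, Nat.add_eq_zero_iff, one_ne_zero, and_false,
      not_false_eq_true, zero_pow, zero_mul, zero_sub] at hS
    rw [show n + 2 + 1 = n + 1 + 2 by ring, integral_sin_pow_zero_pi_div_two, hS, pow_add]
    rw [mul_assoc (sin φ ^ (n + 1)), mul_comm (sin φ ^ 2), mul_assoc, mul_assoc, h]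
    push_cast
    field_simp
    linear_combination (n + 3) * (n + 2) * ih

lemma incBeta_sin_sq {φ : ℝ} (h0 : 0 < φ) (h1 : φ < π / 2) (n : ℕ) :
    incBeta (sin φ ^ 2) (((n : ℝ) + 1) / 2) (1 / 2) = 2 * ∫ θ in 0..φ, sin θ ^ n := by
  have hsub := intervalIntegral.integral_comp_mul_deriv_of_deriv_nonneg (a := 0) (b := φ)
    (f := fun θ ↦ sin θ ^ 2) (f' := fun θ ↦ 2 * sin θ * cos θ)
    (g := fun t ↦ t ^ (((n : ℝ) + 1) / 2 - 1) * (1 - t) ^ ((1 / 2 : ℝ) - 1)) (by fun_prop)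
    (fun θ _ ↦ by simpa using (hasDerivAt_sin θ).fun_pow 2) (fun θ hθ ↦ by
      rw [min_eq_left h0.le, max_eq_right h0.le] at hθ
      have hc : 0 < cos θ := cos_pos_of_mem_Ioo ⟨by linarith [hθ.1], by linarith [hθ.2]⟩
      have hs : 0 < sin θ := sin_pos_of_pos_of_lt_pi hθ.1 (by linarith [hθ.2, pi_pos])
      positivity)
  rw [sin_zero, zero_pow two_ne_zero] at hsub
  rw [incBeta, ← hsub, ← intervalIntegral.integral_const_mul]
  refine intervalIntegral.integral_congr_Ioo_of_le h0.le fun θ hθ ↦ ?_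
  have hc : 0 < cos θ := cos_pos_of_mem_Ioo ⟨by linarith [hθ.1], by linarith [hθ.2]⟩
  have hs : 0 < sin θ := sin_pos_of_pos_of_lt_pi hθ.1 (by linarith [hθ.2, pi_pos])
  have e1 : (sin θ ^ 2) ^ (((n : ℝ) + 1) / 2 - 1) = sin θ ^ n / sin θ := by
    rw [← rpow_natCast (sin θ) 2, ← rpow_mul hs.le,
      show ((2 : ℕ) : ℝ) * (((n : ℝ) + 1) / 2 - 1) = n - 1 by push_cast; ring,
      rpow_sub_one hs.ne', rpow_natCast]
  have e2 : (1 - sin θ ^ 2) ^ ((1 / 2 : ℝ) - 1) = (cos θ)⁻¹ := by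
    rw [← cos_sq', ← rpow_natCast (cos θ) 2, ← rpow_mul hc.le,
      show ((2 : ℕ) : ℝ) * ((1 / 2 : ℝ) - 1) = -1 by push_cast; ring, rpow_neg_one]
  simp only [Function.comp_apply, e1, e2]
  field_simp

lemma integral_eq_integral_sin_pow_div {α : ℝ} (h0 : 0 < α) (h1 : α < π) (n : ℕ) :
    ∫ η in α..π, (1 + cos η) ^ ((n : ℝ) / 2) * sin η / ((1 - cos η) * √(cos α - cos η)) =
      2 ^ (((n : ℝ) + 1) / 2) * sin (π / 2 - α / 2) ^ (n + 1) *
        ∫ θ in 0..π / 2, sin θ ^ (n + 1) / (1 - sin (π / 2 - α / 2) ^ 2 * sin θ ^ 2) := by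
  set φ := π / 2 - α / 2 with hφ
  have hα : α = π - 2 * φ := by rw [hφ]; ring
  have hc : 0 < cos φ := cos_pos_of_mem_Ioo ⟨by linarith, by linarith⟩
  have hs : 0 < sin φ := sin_pos_of_pos_of_lt_pi (by linarith) (by linarith [pi_pos])
  have hs1 : sin φ < 1 := by nlinarith [sin_sq_add_cos_sq φ]
  have hb (θ : ℝ) : -1 < sin φ * sin θ ∧ sin φ * sin θ < 1 := by
    constructor <;> nlinarith [neg_one_le_sin θ, sin_le_one θ]
  have hpi : 0 < π / 2 := by positivity
  have hsub := intervalIntegral.integral_comp_mul_deriv_of_deriv_nonpos (a := 0) (b := π / 2)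
    (f := fun θ ↦ 2 * arccos (sin φ * sin θ))
    (f' := fun θ ↦ 2 * (-(1 / √(1 - (sin φ * sin θ) ^ 2)) * (sin φ * cos θ)))
    (g := fun η ↦ (1 + cos η) ^ ((n : ℝ) / 2) * sin η / ((1 - cos η) * √(cos α - cos η)))
    (by fun_prop)
    (fun θ _ ↦ (HasDerivAt.comp (h₂ := arccos) θ (hasDerivAt_arccos (hb θ).1.ne' (hb θ).2.ne)
      ((hasDerivAt_sin θ).const_mul (sin φ))).const_mul 2)
    (fun θ hθ ↦ by
      rw [min_eq_left hpi.le, max_eq_right hpi.le] at hθ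
      have hcθ : 0 < cos θ := cos_pos_of_mem_Ioo ⟨by linarith [hθ.1], hθ.2⟩
      have : 0 ≤ 1 / √(1 - (sin φ * sin θ) ^ 2) * (sin φ * cos θ) := by positivity
      linarith)
  have ha : 2 * arccos (sin φ * sin (π / 2)) = α := by
    rw [sin_pi_div_two, mul_one, arccos, arcsin_sin (by linarith) (by linarith)]; linarith
  rw [ha, sin_zero, mul_zero, arccos_zero, mul_div_cancel₀ _ two_ne_zero] at hsub
  rw [intervalIntegral.integral_symm, ← hsub, ← intervalIntegral.integral_neg,
    ← intervalIntegral.integral_const_mul]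
  refine intervalIntegral.integral_congr_Ioo_of_le hpi.le fun θ hθ ↦ ?_
  have hcθ : 0 < cos θ := cos_pos_of_mem_Ioo ⟨by linarith [hθ.1], hθ.2⟩
  have hsθ : 0 < sin θ := sin_pos_of_pos_of_lt_pi hθ.1 (by linarith [hθ.2])
  have hD := one_sub_sin_sq_mul_sin_sq_pos hc θ
  have hcosA : cos (arccos (sin φ * sin θ)) = sin φ * sin θ :=
    cos_arccos (hb θ).1.le (hb θ).2.le
  have hcos : cos (2 * arccos (sin φ * sin θ)) = 2 * (sin φ * sin θ) ^ 2 - 1 := by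
    rw [cos_two_mul, hcosA]
  have hsin : sin (2 * arccos (sin φ * sin θ)) =
      2 * √(1 - (sin φ * sin θ) ^ 2) * (sin φ * sin θ) := by
    rw [sin_two_mul, hcosA, sin_arccos]
  have hcα : cos α = 2 * sin φ ^ 2 - 1 := by
    rw [hα, cos_pi_sub, cos_two_mul, cos_sq']; ring
  have hroot : √(cos α - cos (2 * arccos (sin φ * sin θ))) = √2 * (sin φ * cos θ) := by
    rw [hcα, hcos, show 2 * sin φ ^ 2 - 1 - (2 * (sin φ * sin θ) ^ 2 - 1) =
      2 * (sin φ * cos θ) ^ 2 by rw [mul_pow _ (cos θ), cos_sq' θ]; ring,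
      sqrt_mul zero_le_two, sqrt_sq (by positivity)]
  have hpow : (1 + cos (2 * arccos (sin φ * sin θ))) ^ ((n : ℝ) / 2) =
      2 ^ ((n : ℝ) / 2) * (sin φ * sin θ) ^ n := by
    rw [hcos, show 1 + (2 * (sin φ * sin θ) ^ 2 - 1) = 2 * (sin φ * sin θ) ^ 2 by ring,
      mul_rpow zero_le_two (by positivity), ← rpow_natCast (sin φ * sin θ) 2,
      ← rpow_mul (by positivity),
      show ((2 : ℕ) : ℝ) * ((n : ℝ) / 2) = n by push_cast; ring, rpow_natCast]
  have h2 : (2 : ℝ) ^ (((n : ℝ) + 1) / 2) = 2 ^ ((n : ℝ) / 2) * √2 := by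
    rw [add_div, rpow_add zero_lt_two, sqrt_eq_rpow]
  have hq : √(1 - (sin φ * sin θ) ^ 2) ≠ 0 := (sqrt_pos.2 (by rw [mul_pow]; exact hD)).ne'
  have h22 : √2 ^ 2 = (2 : ℝ) := sq_sqrt zero_le_two
  simp only [Function.comp_apply, hpow, hsin, hroot, h2]
  rw [hcos, show 1 - (2 * (sin φ * sin θ) ^ 2 - 1) = 2 * (1 - sin φ ^ 2 * sin θ ^ 2) by ring]
  have hDne := hD.ne'
  field_simp
  rw [h22]
  ring

/-- For an integer `d ≥ 3` and `0 < α < π`,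
`∫_α^π (1+cos η)^{(d−3)/2} sin η / ((1−cos η) √(cos α − cos η)) dη
  = (√π 2^{(d−3)/2} Γ((d−1)/2)/Γ(d/2−1)) (1−cos α)^{−1/2} B(cos²(α/2); (d−2)/2, 1/2)`. -/
theorem robin_constant_integral (d : ℕ) (hd : 3 ≤ d) (α : ℝ) (h0 : 0 < α) (h1 : α < π) :
    (∫ η in α..π,
        (1 + Real.cos η) ^ (((d:ℝ) - 3)/2) * Real.sin η
          / ((1 - Real.cos η) * Real.sqrt (Real.cos α - Real.cos η)))
      = Real.sqrt π * 2 ^ (((d:ℝ) - 3)/2) * Real.Gamma (((d:ℝ) - 1)/2)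
          / Real.Gamma ((d:ℝ)/2 - 1)
        * (1 - Real.cos α) ^ (-(1:ℝ)/2)
        * incBeta (Real.cos (α/2) ^ 2) (((d:ℝ) - 2)/2) (1/2) := by
  obtain ⟨n, rfl⟩ := Nat.exists_eq_add_of_le' hd
  obtain ⟨φ, hφ⟩ : ∃ φ, φ = π / 2 - α / 2 := ⟨_, rfl⟩
  have h2 : α / 2 = π / 2 - φ := by rw [hφ]; ring
  have hφ0 : 0 < φ := by linarith
  have hφ1 : φ < π / 2 := by linarith
  have hc : 0 < cos φ := cos_pos_of_mem_Ioo ⟨by linarith, hφ1⟩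
  have e1 : (((n + 3 : ℕ) : ℝ) - 3) / 2 = n / 2 := by push_cast; ring
  have e2 : (((n + 3 : ℕ) : ℝ) - 1) / 2 = (n + 2) / 2 := by push_cast; ring
  have e3 : ((n + 3 : ℕ) : ℝ) / 2 - 1 = (n + 1) / 2 := by push_cast; ring
  have e4 : (((n + 3 : ℕ) : ℝ) - 2) / 2 = (n + 1) / 2 := by push_cast; ring
  have hone : (1 - cos α) ^ (-(1 : ℝ) / 2) = (√2 * cos φ)⁻¹ := by
    rw [show α = 2 * (π / 2 - φ) by linarith, cos_two_mul, cos_pi_div_two_sub, sin_sq,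
      show 1 - (2 * (1 - cos φ ^ 2) - 1) = 2 * cos φ ^ 2 by ring, neg_div,
      rpow_neg (by positivity), ← sqrt_eq_rpow, sqrt_mul zero_le_two, sqrt_sq hc.le]
  have hpow : (2 : ℝ) ^ (((n : ℝ) + 1) / 2) = 2 ^ ((n : ℝ) / 2) * √2 := by
    rw [add_div, rpow_add zero_lt_two, sqrt_eq_rpow]
  have key := sin_pow_mul_cos_mul_integral hφ0 hφ1 n
  rw [succ_mul_integral_sin_pow_eq_Gamma] at key
  have h22 : √2 ^ 2 = (2 : ℝ) := sq_sqrt zero_le_two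
  rw [e1, e2, e3, e4, hone, h2, cos_pi_div_two_sub, incBeta_sin_sq hφ0 hφ1,
    integral_eq_integral_sin_pow_div h0 h1, ← hφ, hpow]
  have hG : Gamma (((n : ℝ) + 1) / 2) ≠ 0 := (Gamma_pos_of_pos (by positivity)).ne'
  generalize (∫ θ in 0..π / 2, sin θ ^ (n + 1) / (1 - sin φ ^ 2 * sin θ ^ 2)) = J at key ⊢
  field_simp at key ⊢
  rw [h22]
  linear_combination 2 * key
end
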